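/- Let a, b > 0 and consider the isosceles triangle in ℝ² with vertices A = (0, a), B = (−b, 0), C = (b, 0). Then for every point P ∈ ℝ², W(P) ≥ 2a²b²/(a² + 3b²), with equality if and only if P = (0, 2ab²/(a² + 3b²)); i.e. the minimal sum of squared distances from the sides is 2a²b²/(a² + 3b²), attained at the point (0, 2ab²/(a² + 3b²)), which lies inside the triangle. -/

import Mathlib

noncomputable section

/-- The point `(x, y)` of the Euclidean plane `ℝ²`. -/
def pt (x y : ℝ) : EuclideanSpace ℝ (Fin 2) :=
  (WithLp.equiv 2 (Fin 2 → ℝ)).symm ![x, y]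

/-- The line through `X` and `Y`, i.e. the affine span of `{X, Y}`, as a set. -/
def lineThrough (X Y : EuclideanSpace ℝ (Fin 2)) : Set (EuclideanSpace ℝ (Fin 2)) :=
  (affineSpan ℝ {X, Y} : AffineSubspace ℝ (EuclideanSpace ℝ (Fin 2)))

/-- The distance sum function of the triangle `ABC`:
`V(P) = dist(P, line BC) + dist(P, line CA) + dist(P, line AB)`. -/
def vSum (A B C P : EuclideanSpace ℝ (Fin 2)) : ℝ :=
  Metric.infDist P (lineThrough B C) + Metric.infDist P (lineThrough C A) +
    Metric.infDist P (lineThrough A B)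

/-- The squared-distance sum function of the triangle `ABC`:
`W(P) = dist(P, line BC)² + dist(P, line CA)² + dist(P, line AB)²`. -/
def wSum (A B C P : EuclideanSpace ℝ (Fin 2)) : ℝ :=
  Metric.infDist P (lineThrough B C) ^ 2 + Metric.infDist P (lineThrough C A) ^ 2 +
    Metric.infDist P (lineThrough A B) ^ 2

@[simp]
lemma pt_apply_zero (x y : ℝ) : pt x y 0 = x := rfl

@[simp]
lemma pt_apply_one (x y : ℝ) : pt x y 1 = y := rfl

lemma eq_pt_iff (P : EuclideanSpace ℝ (Fin 2)) (x y : ℝ) :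
    P = pt x y ↔ P 0 = x ∧ P 1 = y := by
  constructor
  · rintro rfl
    exact ⟨rfl, rfl⟩
  · rintro ⟨hx, hy⟩
    ext i
    fin_cases i
    · exact hx
    · exact hy

lemma lineMap_apply_coord (X Y : EuclideanSpace ℝ (Fin 2)) (t : ℝ) (i : Fin 2) :
    AffineMap.lineMap X Y t i = X i + t * (Y i - X i) := by
  simp [AffineMap.lineMap_apply]
  ring

/-- The squared distance from a point to a line in coordinates. -/
lemma infDist_lineThrough_sq (X Y P : EuclideanSpace ℝ (Fin 2))
    (h : 0 < (Y 0 - X 0) ^ 2 + (Y 1 - X 1) ^ 2) :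
    Metric.infDist P (lineThrough X Y) ^ 2 =
      ((Y 0 - X 0) * (P 1 - X 1) - (Y 1 - X 1) * (P 0 - X 0)) ^ 2 /
        ((Y 0 - X 0) ^ 2 + (Y 1 - X 1) ^ 2) := by
  have hdist (t : ℝ) : dist P (AffineMap.lineMap X Y t) ^ 2 =
      (P 0 - (X 0 + t * (Y 0 - X 0))) ^ 2 + (P 1 - (X 1 + t * (Y 1 - X 1))) ^ 2 := by
    simp [EuclideanSpace.dist_sq_eq, Fin.sum_univ_two, lineMap_apply_coord, Real.dist_eq, sq_abs]
  set n := (Y 0 - X 0) ^ 2 + (Y 1 - X 1) ^ 2 with hn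
  set c := (Y 0 - X 0) * (P 1 - X 1) - (Y 1 - X 1) * (P 0 - X 0) with hc
  set t₀ := ((Y 0 - X 0) * (P 0 - X 0) + (Y 1 - X 1) * (P 1 - X 1)) / n with ht₀
  have hsplit (t : ℝ) : dist P (AffineMap.lineMap X Y t) ^ 2 = c ^ 2 / n + n * (t - t₀) ^ 2 := by
    rw [hdist, ht₀]
    field_simp
    rw [hc, hn]
    ring
  have hfoot : Metric.infDist P (lineThrough X Y) = dist P (AffineMap.lineMap X Y t₀) := by
    have hmem : AffineMap.lineMap X Y t₀ ∈ lineThrough X Y :=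
      AffineMap.lineMap_mem_affineSpan_pair t₀ X Y
    refine le_antisymm (Metric.infDist_le_dist_of_mem hmem) ?_
    refine (Metric.le_infDist ⟨_, hmem⟩).2 fun Q hQ => ?_
    obtain ⟨t, rfl⟩ := mem_affineSpan_pair_iff_exists_lineMap_eq.1 hQ
    refine (sq_le_sq₀ dist_nonneg dist_nonneg).1 ?_
    rw [hsplit, hsplit, sub_self]
    nlinarith [mul_nonneg h.le (sq_nonneg (t - t₀))]
  rw [hfoot, hsplit]
  ring

lemma wSum_isosceles (a b : ℝ) (ha : 0 < a) (hb : 0 < b) (P : EuclideanSpace ℝ (Fin 2)) :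
    wSum (pt 0 a) (pt (-b) 0) (pt b 0) P =
      2 * a ^ 2 * b ^ 2 / (a ^ 2 + 3 * b ^ 2) + (2 * a ^ 2 / (a ^ 2 + b ^ 2) * P 0 ^ 2 +
        (a ^ 2 + 3 * b ^ 2) / (a ^ 2 + b ^ 2) *
          (P 1 - 2 * a * b ^ 2 / (a ^ 2 + 3 * b ^ 2)) ^ 2) := by
  unfold wSum
  rw [infDist_lineThrough_sq, infDist_lineThrough_sq, infDist_lineThrough_sq]
  · simp only [pt_apply_zero, pt_apply_one]
    have h₁ : (b - -b) ^ 2 + (0 - 0) ^ 2 = 4 * b ^ 2 := by ring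
    have h₂ : (0 - b) ^ 2 + (a - 0) ^ 2 = a ^ 2 + b ^ 2 := by ring
    have h₃ : (-b - 0) ^ 2 + (0 - a) ^ 2 = a ^ 2 + b ^ 2 := by ring
    rw [h₁, h₂, h₃]
    field_simp
    ring
  all_goals
    simp only [pt_apply_zero, pt_apply_one]
    ring_nf
    positivity

lemma mem_convexHull_isosceles (a b : ℝ) (ha : 0 < a) (hb : 0 < b)
    (P : EuclideanSpace ℝ (Fin 2)) (h₀ : 0 < P 1) (h₁ : a * P 0 + b * P 1 < a * b)
    (h₂ : -(a * P 0) + b * P 1 < a * b) :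
    P ∈ convexHull ℝ ({pt 0 a, pt (-b) 0, pt b 0} : Set (EuclideanSpace ℝ (Fin 2))) := by
  have hsum := (convex_convexHull ℝ
    ({pt 0 a, pt (-b) 0, pt b 0} : Set (EuclideanSpace ℝ (Fin 2)))).sum_mem
    (t := Finset.univ) (z := ![pt 0 a, pt (-b) 0, pt b 0])
    (w := ![P 1 / a, (a * b - (a * P 0 + b * P 1)) / (2 * a * b),
      (a * b - (-(a * P 0) + b * P 1)) / (2 * a * b)])
    (fun i _ => by
      fin_cases i
      · exact div_nonneg h₀.le ha.le
      · exact div_nonneg (sub_nonneg.2 h₁.le) (by positivity)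
      · exact div_nonneg (sub_nonneg.2 h₂.le) (by positivity))
    (by
      simp only [Fin.sum_univ_three, Matrix.cons_val]
      field_simp
      ring)
    (fun i _ => subset_convexHull ℝ _ (by fin_cases i <;> simp))
  convert hsum using 1
  simp only [Fin.sum_univ_three, Matrix.cons_val]
  ext i
  fin_cases i
  · simp
    field_simp
    ring
  · simp
    field_simp

/-- **Conclusion 2.** For the isosceles triangle with vertices `(0,a)`, `(−b,0)`, `(b,0)`,
the minimal sum of squared distances from the sides is `2a²b²/(a²+3b²)`, attained exactly
at the point `(0, 2ab²/(a²+3b²))`, which lies inside the triangle. -/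
theorem stmt_17 (a b : ℝ) (ha : 0 < a) (hb : 0 < b) :
    (∀ P : EuclideanSpace ℝ (Fin 2),
        2 * a ^ 2 * b ^ 2 / (a ^ 2 + 3 * b ^ 2) ≤ wSum (pt 0 a) (pt (-b) 0) (pt b 0) P) ∧
    (∀ P : EuclideanSpace ℝ (Fin 2),
        wSum (pt 0 a) (pt (-b) 0) (pt b 0) P = 2 * a ^ 2 * b ^ 2 / (a ^ 2 + 3 * b ^ 2) ↔
          P = pt 0 (2 * a * b ^ 2 / (a ^ 2 + 3 * b ^ 2))) ∧
    pt 0 (2 * a * b ^ 2 / (a ^ 2 + 3 * b ^ 2)) ∈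
      interior (convexHull ℝ ({pt 0 a, pt (-b) 0, pt b 0} : Set (EuclideanSpace ℝ (Fin 2)))) := by
  have hn : 0 < a ^ 2 + 3 * b ^ 2 := by positivity
  refine ⟨fun P => ?_, fun P => ?_, ?_⟩
  · rw [wSum_isosceles a b ha hb, le_add_iff_nonneg_right]
    positivity
  · rw [wSum_isosceles a b ha hb, add_eq_left, eq_pt_iff,
      add_eq_zero_iff_of_nonneg (by positivity) (by positivity),
      mul_eq_zero_iff_left (by positivity), mul_eq_zero_iff_left (by positivity),
      sq_eq_zero_iff, sq_eq_zero_iff, sub_eq_zero]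
  · refine mem_interior.2 ⟨{P | 0 < P 1 ∧ a * P 0 + b * P 1 < a * b ∧
      -(a * P 0) + b * P 1 < a * b}, fun P hP =>
        mem_convexHull_isosceles a b ha hb P hP.1 hP.2.1 hP.2.2, ?_, ?_⟩
    · refine IsOpen.and (isOpen_lt ?_ ?_) (IsOpen.and (isOpen_lt ?_ ?_) (isOpen_lt ?_ ?_)) <;>
        fun_prop
    · have hlt : b * (2 * a * b ^ 2 / (a ^ 2 + 3 * b ^ 2)) < a * b := by
        rw [← mul_div_assoc, div_lt_iff₀ hn]
        have : 0 < a * b * (a ^ 2 + b ^ 2) := by positivity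
        linarith
      simp only [Set.mem_ofPred_eq, pt_apply_zero, pt_apply_one, mul_zero, neg_zero, zero_add]
      exact ⟨by positivity, hlt, hlt⟩
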